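/- arXiv:math-ph/0211050 — 5 statements merged into one kernel-verified Lean document; each statement's English description precedes it below -/
import Mathlib

section
/- Let e_UV(Z) denote, for each Z > 0, the unique positive solution of C_UV(e) = 1, where C_UV(e) = (2e/π)·√(1 + (1/2)·(e²Z/(4π))²) + ((14 + √6·π)/(4π²))·e². Then Z^{1/3}·e_UV(Z) converges to (2√2·π²)^{1/3} as Z → ∞; in particular e_UV(Z) ≅ c₂·Z^{-1/3} for large Z with c₂ = (2√2·π²)^{1/3}. -/
open Real Filter

/-- The square root in `C_UV` lies between its large-argument asymptote and that asymptote
plus one. -/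
lemma sqrt_one_add_half_sq_bounds {y : ℝ} (hy : 0 ≤ y) :
    y / √2 ≤ √(1 + 1 / 2 * y ^ 2) ∧ √(1 + 1 / 2 * y ^ 2) ≤ 1 + y / √2 := by
  have hsq : (y / √2) ^ 2 = 1 / 2 * y ^ 2 := by
    rw [div_pow, Real.sq_sqrt (by norm_num)]; ring
  have h0 : 0 ≤ y / √2 := by positivity
  constructor
  · apply Real.le_sqrt_of_sq_le
    linarith
  · rw [Real.sqrt_le_left (by positivity)]
    nlinarith

/-- A positive solution `e` of `C_UV(e) = 1` satisfies `e³Z ≈ 2√2·π²`, up to an error that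
vanishes with `e`. -/
lemma cube_mul_bounds {e Z B : ℝ} (he : 0 < e) (hZ : 0 < Z) (hB : 0 ≤ B)
    (h : (2 * e / π) * √(1 + (1 / 2) * (e ^ 2 * Z / (4 * π)) ^ 2) + B * e ^ 2 = 1) :
    2 * √2 * π ^ 2 * (1 - 2 * e / π - B * e ^ 2) ≤ e ^ 3 * Z ∧
      e ^ 3 * Z ≤ 2 * √2 * π ^ 2 := by
  obtain ⟨hl, hu⟩ := sqrt_one_add_half_sq_bounds (y := e ^ 2 * Z / (4 * π)) (by positivity)
  have hc : 0 ≤ 2 * e / π := by positivity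
  have hK : 0 < 2 * √2 * π ^ 2 := by positivity
  have hlow := mul_le_mul_of_nonneg_left hl hc
  have hupp := mul_le_mul_of_nonneg_left hu hc
  have heq : (2 * e / π) * (e ^ 2 * Z / (4 * π) / √2) = e ^ 3 * Z / (2 * √2 * π ^ 2) := by
    field_simp
    norm_num
  have hBe : 0 ≤ B * e ^ 2 := by positivity
  rw [mul_add, heq] at hupp
  rw [heq] at hlow
  constructor
  · rw [← le_div_iff₀' hK]
    linarith
  · rw [← div_le_one hK]
    linarith

lemma rpow_one_third_cube {x : ℝ} (hx : 0 ≤ x) : (x ^ 3) ^ ((1 : ℝ) / 3) = x := by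
  rw [← Real.rpow_natCast, ← Real.rpow_mul hx]
  norm_num

/-- If `e_UV(Z)` denotes, for each `Z > 0`, the unique positive solution of
`C_UV(e) = 1` with
`C_UV(e) = (2e/π)·√(1 + (1/2)·(e²Z/(4π))²) + ((14 + √6·π)/(4π²))·e²`,
then `Z^{1/3}·e_UV(Z) → (2√2·π²)^{1/3}` as `Z → ∞`. -/
theorem eUV_asymptotics (eUV : ℝ → ℝ)
    (heUV : ∀ Z : ℝ, 0 < Z → 0 < eUV Z ∧
      (2 * eUV Z / π) * Real.sqrt (1 + (1 / 2) * ((eUV Z) ^ 2 * Z / (4 * π)) ^ 2)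
        + ((14 + Real.sqrt 6 * π) / (4 * π ^ 2)) * (eUV Z) ^ 2 = 1) :
    Tendsto (fun Z : ℝ => Z ^ ((1 : ℝ) / 3) * eUV Z) atTop
      (nhds ((2 * Real.sqrt 2 * π ^ 2) ^ ((1 : ℝ) / 3))) := by
  set K := 2 * √2 * π ^ 2
  set B := (14 + √6 * π) / (4 * π ^ 2)
  have hbounds : ∀ Z : ℝ, 0 < Z → K * (1 - 2 * eUV Z / π - B * eUV Z ^ 2) ≤ eUV Z ^ 3 * Z ∧
      eUV Z ^ 3 * Z ≤ K := fun Z hZ =>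
    cube_mul_bounds (heUV Z hZ).1 hZ (by positivity) (heUV Z hZ).2
  have hcube : Tendsto (fun Z => eUV Z ^ 3) atTop (nhds 0) := by
    refine tendsto_of_tendsto_of_tendsto_of_le_of_le' tendsto_const_nhds
      (tendsto_const_nhds.div_atTop tendsto_id : Tendsto (fun Z : ℝ => K / id Z) atTop (nhds 0))
      ?_ ?_
    · filter_upwards [eventually_gt_atTop 0] with Z hZ
      exact pow_nonneg (heUV Z hZ).1.le 3
    · filter_upwards [eventually_gt_atTop 0] with Z hZ
      exact (le_div_iff₀ hZ).2 (hbounds Z hZ).2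
  have he : Tendsto eUV atTop (nhds 0) := by
    have h := hcube.rpow_const (p := (1 : ℝ) / 3) (Or.inr (by norm_num))
    rw [Real.zero_rpow (by norm_num)] at h
    refine h.congr' ?_
    filter_upwards [eventually_gt_atTop 0] with Z hZ
    exact rpow_one_third_cube (heUV Z hZ).1.le
  have hlower : Tendsto (fun Z => K * (1 - 2 * eUV Z / π - B * eUV Z ^ 2)) atTop (nhds K) := by
    simpa using
      ((((he.const_mul 2).div_const π).const_sub 1).sub ((he.pow 2).const_mul B)).const_mul K
  have hmain : Tendsto (fun Z => eUV Z ^ 3 * Z) atTop (nhds K) := by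
    refine tendsto_of_tendsto_of_tendsto_of_le_of_le' hlower tendsto_const_nhds ?_ ?_
    · filter_upwards [eventually_gt_atTop 0] with Z hZ using (hbounds Z hZ).1
    · filter_upwards [eventually_gt_atTop 0] with Z hZ using (hbounds Z hZ).2
  refine (hmain.rpow_const (p := (1 : ℝ) / 3) (Or.inr (by norm_num))).congr' ?_
  filter_upwards [eventually_gt_atTop 0] with Z hZ
  have hpos := (heUV Z hZ).1.le
  rw [Real.mul_rpow (pow_nonneg hpos 3) hZ.le, rpow_one_third_cube hpos, mul_comm]
end

section
/- Let a > 0 and define ψ_a : ℝ³ → ℝ by ψ_a(x) = π^{−1/2}·a^{3/2}·exp(−a‖x‖). Then for every x ∈ ℝ³ with x ≠ 0, ψ_a satisfies the hydrogen eigenvalue equation −(1/2)·Δψ_a(x) − (a/‖x‖)·ψ_a(x) = −(a²/2)·ψ_a(x), where Δ denotes the Laplacian on ℝ³ (the sum of the second partial derivatives). -/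
section NormExp

variable {E : Type*} [NormedAddCommGroup E] [InnerProductSpace ℝ E]

lemma hasFDerivAt_norm_of_ne_zero {x : E} (hx : x ≠ 0) :
    HasFDerivAt (fun y : E => ‖y‖) (‖x‖⁻¹ • innerSL ℝ x) x := by
  have h := (hasStrictFDerivAt_norm_sq x).hasFDerivAt.sqrt (by positivity)
  simp only [Real.sqrt_sq (norm_nonneg _)] at h
  convert h using 1
  ext v
  simp
  field_simp

lemma hasFDerivAt_exp_mul_norm (b : ℝ) {x : E} (hx : x ≠ 0) :
    HasFDerivAt (fun y : E => Real.exp (b * ‖y‖))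
      ((b * Real.exp (b * ‖x‖) * ‖x‖⁻¹) • innerSL ℝ x) x := by
  convert ((hasFDerivAt_norm_of_ne_zero hx).const_mul b).exp using 1
  ext v
  simp
  ring

lemma fderiv_const_mul_exp_mul_norm (c b : ℝ) {x : E} (hx : x ≠ 0) (v : E) :
    fderiv ℝ (fun y : E => c * Real.exp (b * ‖y‖)) x v =
      c * b * (Real.exp (b * ‖x‖) * ‖x‖⁻¹ * inner ℝ x v) := by
  rw [((hasFDerivAt_exp_mul_norm b hx).const_mul c).fderiv]
  simp
  ring

lemma fderiv_fderiv_const_mul_exp_mul_norm (c b : ℝ) {x : E} (hx : x ≠ 0) (v : E) :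
    fderiv ℝ (fun y => fderiv ℝ (fun z : E => c * Real.exp (b * ‖z‖)) y v) x v =
      c * Real.exp (b * ‖x‖) *
        (b ^ 2 * inner ℝ x v ^ 2 / ‖x‖ ^ 2 - b * inner ℝ x v ^ 2 / ‖x‖ ^ 3
          + b * ‖v‖ ^ 2 / ‖x‖) := by
  have hev : (fun y => fderiv ℝ (fun z : E => c * Real.exp (b * ‖z‖)) y v) =ᶠ[nhds x]
      fun y => c * b * (Real.exp (b * ‖y‖) * ‖y‖⁻¹ * inner ℝ y v) := by
    filter_upwards [isOpen_ne.mem_nhds hx] with y hy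
    exact fderiv_const_mul_exp_mul_norm c b hy v
  have hr : ‖x‖ ≠ 0 := norm_ne_zero_iff.mpr hx
  have hinv : HasFDerivAt (fun y : E => ‖y‖⁻¹) _ x :=
    (hasDerivAt_inv hr).comp_hasFDerivAt x (hasFDerivAt_norm_of_ne_zero hx)
  have hinner : HasFDerivAt (fun y : E => inner ℝ y v) _ x :=
    (hasFDerivAt_id x).inner ℝ (hasFDerivAt_const v x)
  rw [hev.fderiv_eq,
    ((((hasFDerivAt_exp_mul_norm b hx).fun_mul hinv).fun_mul hinner).const_mul (c * b)).fderiv]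
  simp
  field_simp
  ring

end NormExp

open Real

/-- The hydrogen ground state `ψ_a(x) = π^{−1/2}·a^{3/2}·exp(−a‖x‖)` satisfies, away from
the origin, the eigenvalue equation `−(1/2)·Δψ_a − (a/‖x‖)·ψ_a = −(a²/2)·ψ_a`, where the
Laplacian is the sum of the second partial derivatives along the coordinate directions. -/
theorem hydrogen_ground_state_eigenvalue (a : ℝ) (ha : 0 < a)
    (ψ : EuclideanSpace ℝ (Fin 3) → ℝ)
    (hψ : ψ = fun x => π ^ (-(1 : ℝ) / 2) * a ^ ((3 : ℝ) / 2) * Real.exp (-a * ‖x‖)) :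
    ∀ x : EuclideanSpace ℝ (Fin 3), x ≠ 0 →
      -(1 / 2) * (∑ i : Fin 3,
          fderiv ℝ (fun y => fderiv ℝ ψ y (EuclideanSpace.single i 1)) x
            (EuclideanSpace.single i 1))
        - (a / ‖x‖) * ψ x = -(a ^ 2 / 2) * ψ x := by
  intro x hx
  subst hψ
  have hr : ‖x‖ ≠ 0 := norm_ne_zero_iff.mpr hx
  have hsum : x 0 ^ 2 + x 1 ^ 2 + x 2 ^ 2 = ‖x‖ ^ 2 := by
    simp [EuclideanSpace.norm_sq_eq, Fin.sum_univ_three]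
  simp only [fderiv_fderiv_const_mul_exp_mul_norm _ _ hx, Fin.sum_univ_three,
    EuclideanSpace.inner_single_right, PiLp.norm_single]
  simp only [norm_one, one_mul, conj_trivial]
  generalize π ^ (-(1 : ℝ) / 2) * a ^ ((3 : ℝ) / 2) * Real.exp (-a * ‖x‖) = C
  field_simp
  linear_combination (-C * (a * ‖x‖ + 1)) * hsum
end

section
/- The sine-integral type estimate ∫₀^{100} (1 − cos s)/s ds ≤ γ + log 15 + 91/30 holds, where γ is the Euler–Mascheroni constant. -/
open Real

lemma intervalIntegrable_one_sub_cos_div (a b : ℝ) :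
    IntervalIntegrable (fun s : ℝ => (1 - Real.cos s) / s) MeasureTheory.volume a b := by
  have hg : IntervalIntegrable (fun s : ℝ => |s| / 2) MeasureTheory.volume a b :=
    (continuous_abs.div_const 2).intervalIntegrable a b
  refine hg.mono_fun (Measurable.aestronglyMeasurable (by fun_prop)) (Filter.Eventually.of_forall fun s => ?_)
  have h₁ : 0 ≤ 1 - Real.cos s := by linarith [Real.cos_le_one s]
  beta_reduce
  rw [norm_div, Real.norm_eq_abs, Real.norm_eq_abs, Real.norm_eq_abs, abs_of_nonneg h₁,
    abs_of_nonneg (by positivity : 0 ≤ |s| / 2)]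
  refine div_le_of_le_mul₀ (abs_nonneg s) (by positivity) ?_
  nlinarith [Real.one_sub_sq_div_two_le_cos (x := s), sq_abs s]

lemma integral_one_sub_cos_div_le_sq {a : ℝ} (ha : 0 ≤ a) :
    ∫ s in (0 : ℝ)..a, (1 - Real.cos s) / s ≤ a ^ 2 / 4 := by
  have h : ∫ s in (0 : ℝ)..a, (1 - Real.cos s) / s ≤ ∫ s in (0 : ℝ)..a, s / 2 := by
    refine intervalIntegral.integral_mono_on ha (intervalIntegrable_one_sub_cos_div 0 a)
      ((continuous_id.div_const 2).intervalIntegrable 0 a) fun s hs => ?_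
    refine div_le_of_le_mul₀ hs.1 (by linarith [hs.1]) ?_
    nlinarith [Real.one_sub_sq_div_two_le_cos (x := s)]
  refine h.trans_eq ?_
  rw [intervalIntegral.integral_div, integral_id]
  ring

/-- Away from the origin the integrand is dominated by the derivative of
`log s - sin s / s - 1 / s`. -/
lemma integral_one_sub_cos_div_le_log {a b : ℝ} (ha : 0 < a) (hab : a ≤ b) :
    ∫ s in a..b, (1 - Real.cos s) / s ≤ Real.log (b / a) + 2 / a := by
  have hpos : ∀ s ∈ Set.uIcc a b, 0 < s := fun s hs => by
    rw [Set.uIcc_of_le hab] at hs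
    exact ha.trans_le hs.1
  have hderiv : ∀ s ∈ Set.uIcc a b,
      HasDerivAt (fun s => Real.log s - (Real.sin s + 1) / s)
        (s⁻¹ - (Real.cos s * s - (Real.sin s + 1) * 1) / s ^ 2) s := fun s hs =>
    (Real.hasDerivAt_log (hpos s hs).ne').sub
      (((Real.hasDerivAt_sin s).add_const 1).div (hasDerivAt_id s) (hpos s hs).ne')
  have hint : IntervalIntegrable
      (fun s => s⁻¹ - (Real.cos s * s - (Real.sin s + 1) * 1) / s ^ 2)
      MeasureTheory.volume a b := by
    refine ContinuousOn.intervalIntegrable fun s hs => ContinuousAt.continuousWithinAt ?_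
    have hs' := (hpos s hs).ne'
    have hs2 : s ^ 2 ≠ 0 := pow_ne_zero 2 hs'
    fun_prop (disch := assumption)
  have hle := intervalIntegral.integral_mono_on hab (intervalIntegrable_one_sub_cos_div a b) hint
    fun s hs => by
      have hs' : 0 < s := ha.trans_le hs.1
      have hsin : 0 ≤ (Real.sin s + 1) / s ^ 2 :=
        div_nonneg (by linarith [Real.neg_one_le_sin s]) (by positivity)
      have heq : s⁻¹ - (Real.cos s * s - (Real.sin s + 1) * 1) / s ^ 2
          = (1 - Real.cos s) / s + (Real.sin s + 1) / s ^ 2 := by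
        field_simp
        ring
      rw [heq]
      linarith
  rw [intervalIntegral.integral_eq_sub_of_hasDerivAt hderiv hint] at hle
  have hb : 0 < b := ha.trans_le hab
  have h₁ : 0 ≤ (Real.sin b + 1) / b := div_nonneg (by linarith [Real.neg_one_le_sin b]) hb.le
  have h₂ : (Real.sin a + 1) / a ≤ 2 / a := by
    gcongr
    linarith [Real.sin_le_one a]
  rw [Real.log_div hb.ne' ha.ne']
  linarith

/-- The sine-integral type estimate
`∫₀^{100} (1 − cos s)/s ds ≤ γ + log 15 + 91/30`,
where `γ` is the Euler–Mascheroni constant. -/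
theorem sine_integral_bound_hundred :
    ∫ s in (0 : ℝ)..100, (1 - Real.cos s) / s
      ≤ Real.eulerMascheroniConstant + Real.log 15 + 91 / 30 := by
  rw [← intervalIntegral.integral_add_adjacent_intervals
    (intervalIntegrable_one_sub_cos_div 0 2) (intervalIntegrable_one_sub_cos_div 2 100)]
  have h₁ := integral_one_sub_cos_div_le_sq (a := 2) (by norm_num)
  have h₂ := integral_one_sub_cos_div_le_log (a := 2) (b := 100) (by norm_num) (by norm_num)
  have h₃ : Real.log (100 / 2) = Real.log 15 + Real.log (10 / 3) := by
    rw [← Real.log_mul (by norm_num) (by norm_num)]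
    norm_num
  have h₄ : Real.log (10 / 3) ≤ 3 / 2 := by
    rw [Real.log_le_iff_le_exp (by norm_num)]
    linarith [Real.quadratic_le_exp_of_nonneg (x := 3 / 2) (by norm_num)]
  linarith [Real.one_half_lt_eulerMascheroniConstant]
end

section
/- Let R > 0 and c > 0. Define χ_R : ℝ → ℝ by χ_R(r) = min(max(2r/R − 1, 0), 1) (so χ_R = 0 on (−∞, R/2], χ_R = 1 on [R, ∞), linear in between), and define G : ℝ³ → ℝ by G(x) = χ_R(‖x‖)·√(log(3 + c‖x‖)). Then at every point x ∈ ℝ³ at which G is differentiable, the gradient satisfies ‖∇G(x)‖² ≤ 4R^{−2}·log(3 + cR) + 5R^{−2}. -/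
open Real

/-- The radial profile of the localization function. -/
noncomputable def radialLogCutoff (R c r : ℝ) : ℝ :=
  min (max (2 * r / R - 1) 0) 1 * √(log (3 + c * r))

lemma one_le_log_three_add {t : ℝ} (ht : 0 ≤ t) : 1 ≤ log (3 + t) := by
  rw [le_log_iff_exp_le (by linarith)]
  linarith [exp_one_lt_d9]

lemma hasDerivAt_sqrt_log_three_add {c r : ℝ} (hc : 0 < c) (hr : 0 ≤ r) :
    HasDerivAt (fun s => √(log (3 + c * s)))
      (c / (3 + c * r) / (2 * √(log (3 + c * r)))) r := by
  have hcr : 0 ≤ c * r := by positivity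
  have h1 : HasDerivAt (fun s => 3 + c * s) c r := by
    simpa using ((hasDerivAt_id r).const_mul c).const_add 3
  exact (h1.log (by positivity)).sqrt (by linarith [one_le_log_three_add hcr])

lemma continuousOn_radialLogCutoff {R c : ℝ} (hc : 0 < c) :
    ContinuousOn (radialLogCutoff R c) (Set.Ici 0) := by
  refine ContinuousOn.mul (by fun_prop) fun r hr => ?_
  exact (hasDerivAt_sqrt_log_three_add hc hr).continuousAt.continuousWithinAt

lemma exists_right_deriv_radialLogCutoff {R c r : ℝ} (hR : 0 < R) (hc : 0 < c) (hr : 0 ≤ r) :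
    ∃ v, HasDerivWithinAt (radialLogCutoff R c) v (Set.Ici r) r ∧
      v ^ 2 ≤ 4 / R ^ 2 * log (3 + c * R) + 5 / R ^ 2 := by
  have hL : 1 ≤ log (3 + c * r) := one_le_log_three_add (by positivity)
  have hLR : 1 ≤ log (3 + c * R) := one_le_log_three_add (by positivity)
  have hderiv := hasDerivAt_sqrt_log_three_add hc hr
  set q := c / (3 + c * r) with hq
  have hq0 : 0 ≤ q := by positivity
  have hqr : q * r ≤ 1 := by
    rw [hq, div_mul_eq_mul_div, div_le_one (by positivity)]
    linarith
  have hsq : √(log (3 + c * r)) ^ 2 = log (3 + c * r) := sq_sqrt (by linarith)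
  have hS : 1 ≤ √(log (3 + c * r)) := one_le_sqrt.mpr hL
  have hmem := self_mem_nhdsWithin (a := r) (s := Set.Ici r)
  rcases lt_or_ge r (R / 2) with h | h
  · refine ⟨0, ?_, by rw [zero_pow two_ne_zero]; positivity⟩
    refine (hasDerivWithinAt_const r _ (0 : ℝ)).congr_of_eventuallyEq_of_mem ?_ Set.self_mem_Ici
    filter_upwards [mem_nhdsWithin_of_mem_nhds (Iio_mem_nhds h)] with s hs
    have : 2 * s / R - 1 ≤ 0 := by
      rw [sub_nonpos, div_le_one hR]
      linarith [Set.mem_Iio.mp hs]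
    simp [radialLogCutoff, max_eq_right this]
  rcases lt_or_ge r R with h' | h'
  · set u := 2 * r / R - 1 with hu
    have hu0 : 0 ≤ u := by
      rw [hu, sub_nonneg, le_div_iff₀ hR]
      linarith
    have hlin : HasDerivAt (fun s : ℝ => 2 * s / R - 1) (2 / R) r := by
      simpa using (((hasDerivAt_id r).const_mul 2).div_const R).sub_const 1
    refine ⟨_, ((hlin.mul hderiv).hasDerivWithinAt).congr_of_eventuallyEq_of_mem ?_
      Set.self_mem_Ici, ?_⟩
    · filter_upwards [hmem, mem_nhdsWithin_of_mem_nhds (Iio_mem_nhds h')] with s hs hs'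
      have h0 : 0 ≤ 2 * s / R - 1 := by
        rw [sub_nonneg, le_div_iff₀ hR]
        linarith [Set.mem_Ici.mp hs]
      have h1 : 2 * s / R - 1 ≤ 1 := by
        rw [sub_le_iff_le_add, div_le_iff₀ hR]
        linarith [Set.mem_Iio.mp hs']
      simp [radialLogCutoff, max_eq_left h0, min_eq_left h1]
    · have huq : u * q ≤ 1 / R := by
        rw [le_div_iff₀ hR]
        have : u * R = 2 * r - R := by rw [hu]; field_simp
        nlinarith
      have hmono : log (3 + c * r) ≤ log (3 + c * R) :=
        log_le_log (by positivity) (by gcongr)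
      rw [← hu]
      set S := √(log (3 + c * r))
      have hexp : (2 / R * S + u * (q / (2 * S))) ^ 2 =
          4 / R ^ 2 * S ^ 2 + 2 / R * (u * q) + (u * q) ^ 2 / (4 * S ^ 2) := by
        field_simp
        ring
      have h2 : 2 / R * (u * q) ≤ 2 / R ^ 2 := by
        calc 2 / R * (u * q) ≤ 2 / R * (1 / R) := by gcongr
          _ = 2 / R ^ 2 := by field_simp
      have h3 : (u * q) ^ 2 / (4 * S ^ 2) ≤ 1 / R ^ 2 := by
        calc (u * q) ^ 2 / (4 * S ^ 2) ≤ (u * q) ^ 2 :=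
              div_le_self (by positivity) (by nlinarith)
          _ ≤ (1 / R) ^ 2 := by gcongr
          _ = 1 / R ^ 2 := by field_simp
      have h1 : 4 / R ^ 2 * S ^ 2 ≤ 4 / R ^ 2 * log (3 + c * R) := by
        rw [hsq]; gcongr
      have h4 : 2 / R ^ 2 + 1 / R ^ 2 ≤ 5 / R ^ 2 := by
        rw [← add_div]; gcongr; norm_num
      linarith
  · refine ⟨_, hderiv.hasDerivWithinAt.congr_of_eventuallyEq_of_mem ?_ Set.self_mem_Ici, ?_⟩
    · filter_upwards [hmem] with s hs
      have h1 : 1 ≤ 2 * s / R - 1 := by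
        rw [le_sub_iff_add_le, le_div_iff₀ hR]
        linarith [Set.mem_Ici.mp hs]
      simp [radialLogCutoff, max_eq_left (zero_le_one.trans h1), min_eq_right h1]
    · have hqR : q ≤ 1 / R := by
        rw [le_div_iff₀ hR]
        nlinarith
      calc (q / (2 * √(log (3 + c * r)))) ^ 2 ≤ (1 / R) ^ 2 := by
            have h2S : 1 ≤ 2 * √(log (3 + c * r)) := by linarith
            exact pow_le_pow_left₀ (by positivity) ((div_le_self hq0 h2S).trans hqR) 2
        _ = 1 / R ^ 2 := by field_simp
        _ ≤ 5 / R ^ 2 := by gcongr; norm_num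
        _ ≤ _ := le_add_of_nonneg_left (by positivity)

lemma abs_radialLogCutoff_sub_le {R c a b : ℝ} (hR : 0 < R) (hc : 0 < c) (ha : 0 ≤ a)
    (hb : 0 ≤ b) :
    |radialLogCutoff R c b - radialLogCutoff R c a| ≤
      √(4 / R ^ 2 * log (3 + c * R) + 5 / R ^ 2) * |b - a| := by
  wlog hab : a ≤ b generalizing a b
  · rw [abs_sub_comm, abs_sub_comm b]
    exact this hb ha (le_of_not_ge hab)
  rw [abs_of_nonneg (sub_nonneg.mpr hab)]
  have hex : ∀ r, ∃ v, 0 ≤ r → HasDerivWithinAt (radialLogCutoff R c) v (Set.Ici r) r ∧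
      v ^ 2 ≤ 4 / R ^ 2 * log (3 + c * R) + 5 / R ^ 2 := fun r => by
    by_cases hr : 0 ≤ r
    · obtain ⟨v, hv⟩ := exists_right_deriv_radialLogCutoff hR hc hr
      exact ⟨v, fun _ => hv⟩
    · exact ⟨0, fun h => absurd h hr⟩
  choose v hv using hex
  exact norm_image_sub_le_of_norm_deriv_right_le_segment
    ((continuousOn_radialLogCutoff hc).mono fun r hr => ha.trans hr.1)
    (fun r hr => (hv r (ha.trans hr.1)).1)
    (fun r hr => abs_le_sqrt (hv r (ha.trans hr.1)).2) b ⟨hab, le_rfl⟩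

/-- Gradient bound for the logarithmic localization function
`G(x) = χ_R(‖x‖)·√(log(3 + c‖x‖))` with the piecewise-linear cutoff
`χ_R(r) = min(max(2r/R − 1, 0), 1)`: wherever `G` is differentiable,
`‖∇G(x)‖² ≤ 4R^{−2}·log(3 + cR) + 5R^{−2}`. -/
theorem gradient_bound_log_localization (R c : ℝ) (hR : 0 < R) (hc : 0 < c) :
    ∀ x : EuclideanSpace ℝ (Fin 3),
      DifferentiableAt ℝ (fun y : EuclideanSpace ℝ (Fin 3) =>
        min (max (2 * ‖y‖ / R - 1) 0) 1 * Real.sqrt (Real.log (3 + c * ‖y‖))) x →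
      ‖gradient (fun y : EuclideanSpace ℝ (Fin 3) =>
          min (max (2 * ‖y‖ / R - 1) 0) 1 * Real.sqrt (Real.log (3 + c * ‖y‖))) x‖ ^ 2
        ≤ 4 / R ^ 2 * Real.log (3 + c * R) + 5 / R ^ 2 := by
  intro x _
  have hB : 0 ≤ 4 / R ^ 2 * log (3 + c * R) + 5 / R ^ 2 := by
    have := one_le_log_three_add (mul_pos hc hR).le
    positivity
  rw [gradient, LinearIsometryEquiv.norm_map, ← le_sqrt (norm_nonneg _) hB]
  refine norm_fderiv_le_of_lip' ℝ (sqrt_nonneg _) (Filter.Eventually.of_forall fun y => ?_)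
  calc |radialLogCutoff R c ‖y‖ - radialLogCutoff R c ‖x‖|
      ≤ √(4 / R ^ 2 * log (3 + c * R) + 5 / R ^ 2) * |‖y‖ - ‖x‖| :=
        abs_radialLogCutoff_sub_le hR hc (norm_nonneg x) (norm_nonneg y)
    _ ≤ √(4 / R ^ 2 * log (3 + c * R) + 5 / R ^ 2) * ‖y - x‖ := by
        gcongr
        exact abs_norm_sub_norm_le y x
end

section
/- Let R > 0. Define χ_R : ℝ → ℝ by χ_R(r) = min(max(2r/R − 1, 0), 1) (so χ_R = 0 on (−∞, R/2], χ_R = 1 on [R, ∞), linear in between), and define G : ℝ³ → ℝ by G(x) = χ_R(‖x‖)·‖x‖^{1/2}. Then at every point x ∈ ℝ³ at which G is differentiable, the gradient satisfies ‖∇G(x)‖² ≤ 7/R. -/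
open Real

/-- The profile `u ↦ min (max (2u² - 1) 0) 1 * u` is monotone on `[0, ∞)`. -/
lemma clamp_mul_self_mono {u v : ℝ} (hu : 0 ≤ u) (huv : u ≤ v) :
    min (max (2 * u ^ 2 - 1) 0) 1 * u ≤ min (max (2 * v ^ 2 - 1) 0) 1 * v := by
  have hv : 0 ≤ v := hu.trans huv
  gcongr

/-- One-sided form of the `5/2`-Lipschitz bound for the profile in the variable `u²`. -/
lemma clamp_mul_self_sub_le {u v : ℝ} (hu : 0 ≤ u) (huv : u ≤ v) :
    min (max (2 * v ^ 2 - 1) 0) 1 * v - min (max (2 * u ^ 2 - 1) 0) 1 * u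
      ≤ 5 / 2 * (v ^ 2 - u ^ 2) := by
  have hv : 0 ≤ v := hu.trans huv
  have hlow (hu1 : u ≤ 1) :
      (2 * u ^ 2 - 1) * u ≤ min (max (2 * u ^ 2 - 1) 0) 1 * u :=
    mul_le_mul_of_nonneg_right (le_min (le_max_left _ _) (by nlinarith)) hu
  rcases le_total v 1 with hv1 | hv1
  · rcases le_total (2 * v ^ 2 - 1) 0 with h | h
    · rw [max_eq_right h]
      have h0 : 0 ≤ min (max (2 * u ^ 2 - 1) 0) 1 * u := by positivity
      norm_num
      nlinarith
    · have h1 : min (max (2 * v ^ 2 - 1) 0) 1 = 2 * v ^ 2 - 1 := by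
        rw [max_eq_left h, min_eq_left (by nlinarith)]
      rw [h1]
      have hu1 : u ≤ 1 := huv.trans hv1
      have key : 2 * (v ^ 2 + u * v + u ^ 2) - 1 ≤ 5 / 2 * (u + v) := by
        nlinarith [mul_nonneg hu (sub_nonneg.2 hv1), mul_nonneg hv (sub_nonneg.2 hu1),
          mul_nonneg hu (sub_nonneg.2 hu1), mul_nonneg hv (sub_nonneg.2 hv1)]
      nlinarith [hlow hu1, mul_le_mul_of_nonneg_left key (sub_nonneg.2 huv)]
  · have clamp_one {w : ℝ} (hw : 1 ≤ w) : min (max (2 * w ^ 2 - 1) 0) 1 = 1 :=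
      min_eq_right (le_max_of_le_left (by nlinarith))
    rw [clamp_one hv1]
    rcases le_total u 1 with hu1 | hu1
    · nlinarith [hlow hu1, mul_nonneg hu (sub_nonneg.2 hu1),
        mul_nonneg (mul_nonneg hu (sub_nonneg.2 hu1)) (sub_nonneg.2 hu1)]
    · rw [clamp_one hu1]
      nlinarith

/-- The radial profile of the localization function is Lipschitz on `[0, ∞)` with constant
`5 / (2√R)`. -/
lemma abs_cutoff_mul_sqrt_sub_le {R r s : ℝ} (hR : 0 < R) (hr : 0 ≤ r) (hs : 0 ≤ s) :
    |min (max (2 * r / R - 1) 0) 1 * √r - min (max (2 * s / R - 1) 0) 1 * √s|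
      ≤ 5 / (2 * √R) * |r - s| := by
  wlog hsr : s ≤ r generalizing r s
  · rw [abs_sub_comm, abs_sub_comm r]
    exact this hs hr (le_of_not_ge hsr)
  have hq : 0 < √R := sqrt_pos.2 hR
  have hR' : √R ^ 2 = R := sq_sqrt hR.le
  have resc {t : ℝ} (ht : 0 ≤ t) : min (max (2 * t / R - 1) 0) 1 * √t =
      √R * (min (max (2 * (√t / √R) ^ 2 - 1) 0) 1 * (√t / √R)) := by
    rw [div_pow, sq_sqrt ht, hR', ← mul_div_assoc]
    field_simp
  have huv : √s / √R ≤ √r / √R := by gcongr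
  have hu : 0 ≤ √s / √R := by positivity
  rw [resc hr, resc hs, ← mul_sub, abs_mul, abs_of_pos hq,
    abs_of_nonneg (sub_nonneg.2 (clamp_mul_self_mono hu huv)), abs_of_nonneg (sub_nonneg.2 hsr)]
  calc _ ≤ √R * (5 / 2 * ((√r / √R) ^ 2 - (√s / √R) ^ 2)) := by
        gcongr
        exact clamp_mul_self_sub_le hu huv
    _ = _ := by
        rw [div_pow, div_pow, sq_sqrt hr, sq_sqrt hs]
        field_simp

/-- Gradient bound for the localization function `G(x) = χ_R(‖x‖)·‖x‖^{1/2}` with the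
piecewise-linear cutoff `χ_R(r) = min(max(2r/R − 1, 0), 1)`: wherever `G` is
differentiable, `‖∇G(x)‖² ≤ 7/R`. -/
theorem gradient_bound_sqrt_localization (R : ℝ) (hR : 0 < R) :
    ∀ x : EuclideanSpace ℝ (Fin 3),
      DifferentiableAt ℝ (fun y : EuclideanSpace ℝ (Fin 3) =>
        min (max (2 * ‖y‖ / R - 1) 0) 1 * ‖y‖ ^ ((1 : ℝ) / 2)) x →
      ‖gradient (fun y : EuclideanSpace ℝ (Fin 3) =>
          min (max (2 * ‖y‖ / R - 1) 0) 1 * ‖y‖ ^ ((1 : ℝ) / 2)) x‖ ^ 2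
        ≤ 7 / R := by
  intro x _
  simp only [← sqrt_eq_rpow]
  have hC : 0 ≤ 5 / (2 * √R) := by positivity
  rw [gradient, LinearIsometryEquiv.norm_map]
  refine (pow_le_pow_left₀ (norm_nonneg _) (norm_fderiv_le_of_lip' ℝ hC
    (Filter.Eventually.of_forall fun y => ?_)) 2).trans ?_
  · exact (abs_cutoff_mul_sqrt_sub_le hR (norm_nonneg y) (norm_nonneg x)).trans
      (mul_le_mul_of_nonneg_left (abs_norm_sub_norm_le y x) hC)
  · rw [div_pow, mul_pow, sq_sqrt hR.le, div_le_div_iff₀ (by positivity) hR]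
    linarith
end
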